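/- arXiv:2207.01215 — 2 statements merged into one kernel-verified Lean document; each statement's English description precedes it below -/
import Mathlib

section
/- Fix m ≥ 1 and a subgroup A ≤ S_m. The set of real numbers {δ(A≀_I B) : n ∈ ℕ, B ≤ S_n an imprimitive permutation group} is dense in the interval [δ(A), 1]. -/
open Equiv Finset

/-- The number of fixed points of a permutation. -/
noncomputable def fixCnt {X : Type*} (g : Equiv.Perm X) : ℕ := {x | g x = x}.ncard

/-- The proportion of elements `a` of the set `C` such that the permutation `f a`
has exactly `k` fixed points. -/
noncomputable def propFixVia {α X : Type*} (f : α → Equiv.Perm X) (C : Set α) (k : ℕ) : ℝ :=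
  (({a ∈ C | fixCnt (f a) = k}).ncard : ℝ) / (C.ncard : ℝ)

/-- `δ_k(C)`: the proportion of elements of `C ⊆ Sym(X)` with exactly `k` fixed points. -/
noncomputable def propFix {X : Type*} (C : Set (Equiv.Perm X)) (k : ℕ) : ℝ :=
  propFixVia id C k

/-- The element `(α, b)` of the wreath product acting on `X × Y` via the imprimitive
action `(x, y) ↦ (x α(y), y b)`. -/
def imprimPerm {X Y : Type*} (α : Y → Equiv.Perm X) (b : Equiv.Perm Y) :
    Equiv.Perm (X × Y) where
  toFun p := (α p.2 p.1, b p.2)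
  invFun p := ((α (b⁻¹ p.2))⁻¹ p.1, b⁻¹ p.2)
  left_inv p := by simp
  right_inv p := by simp

/-- The element `(α, b)` of the wreath product acting on `X^Y` via the power action
`(ω(α,b))(y) = ω(y b⁻¹) α(y b⁻¹)`. -/
def powerPerm {X Y : Type*} (α : Y → Equiv.Perm X) (b : Equiv.Perm Y) :
    Equiv.Perm (Y → X) where
  toFun ω y := α (b⁻¹ y) (ω (b⁻¹ y))
  invFun ω y := (α y)⁻¹ (ω (b y))
  left_inv ω := by funext y; simp
  right_inv ω := by funext y; simp

/-- The number of cycles of a permutation in its disjoint cycle decomposition,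
where fixed points are counted as 1-cycles. -/
noncomputable def cycleCnt {Y : Type*} [Fintype Y] [DecidableEq Y] (b : Equiv.Perm Y) : ℕ :=
  b.cycleType.card + fixCnt b

/-- The underlying set of the wreath product `A ≀ B` (pairs `(α, b)`). -/
def wreathSet {m n : ℕ} (A : Subgroup (Equiv.Perm (Fin m))) (B : Subgroup (Equiv.Perm (Fin n))) :
    Set ((Fin n → Equiv.Perm (Fin m)) × Equiv.Perm (Fin n)) :=
  {p | (∀ y, p.1 y ∈ A) ∧ p.2 ∈ B}

/-- `δ_k(A ≀_I B)` for the imprimitive action on `[m] × [n]`. -/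
noncomputable def deltaI {m n : ℕ} (A : Subgroup (Equiv.Perm (Fin m)))
    (B : Subgroup (Equiv.Perm (Fin n))) (k : ℕ) : ℝ :=
  propFixVia (fun p => imprimPerm p.1 p.2) (wreathSet A B) k

/-- `δ_k(A ≀_P B)` for the power action on `[m]^[n]`. -/
noncomputable def deltaP {m n : ℕ} (A : Subgroup (Equiv.Perm (Fin m)))
    (B : Subgroup (Equiv.Perm (Fin n))) (k : ℕ) : ℝ :=
  propFixVia (fun p => powerPerm p.1 p.2) (wreathSet A B) k

/-- `[B, ℓ]`: the number of elements of `B` with exactly `ℓ` cycles. -/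
noncomputable def stirCnt {n : ℕ} (B : Subgroup (Equiv.Perm (Fin n))) (ℓ : ℕ) : ℕ :=
  {b ∈ (B : Set (Equiv.Perm (Fin n))) | cycleCnt b = ℓ}.ncard

/-- A subgroup `A ≤ Sym(X)` is primitive if it is transitive and every block is trivial
(equivalently, it preserves no nontrivial partition of `X`). -/
def IsPrimitiveSubgroup {X : Type*} (A : Subgroup (Equiv.Perm X)) : Prop :=
  MulAction.IsPretransitive A X ∧
  ∀ s : Set X, MulAction.IsBlock A s → s.Subsingleton ∨ s = Set.univ


/-- A subgroup `B ≤ Sym(X)` is imprimitive if it is transitive but preserves some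
nontrivial partition of `X`, i.e. is transitive but not primitive. -/
def IsImprimitiveSubgroup {X : Type*} (B : Subgroup (Equiv.Perm X)) : Prop :=
  MulAction.IsPretransitive B X ∧ ¬ IsPrimitiveSubgroup B

lemma fixCnt_eq_card {X : Type*} [Fintype X] [DecidableEq X] (g : Equiv.Perm X) :
    fixCnt g = #{x | g x = x} := by
  rw [fixCnt, ← Set.ncard_coe_finset]; simp

lemma fixCnt_eq_zero_iff {X : Type*} [Finite X] (g : Equiv.Perm X) :
    fixCnt g = 0 ↔ ∀ x, g x ≠ x := by
  rw [fixCnt, Set.ncard_eq_zero (Set.toFinite _), Set.eq_empty_iff_forall_notMem]; rfl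

lemma fixCnt_imprimPerm_eq_zero_iff {X Y : Type*} [Finite X] [Finite Y]
    (α : Y → Equiv.Perm X) (b : Equiv.Perm Y) :
    fixCnt (imprimPerm α b) = 0 ↔ ∀ y, b y = y → fixCnt (α y) = 0 := by
  simp only [fixCnt_eq_zero_iff, imprimPerm, Prod.forall]
  simp only [Equiv.coe_fn_mk, ne_eq, Prod.mk.injEq, not_and]
  exact ⟨fun h y hy x hx => h x y hx hy, fun h x y hx hy => h y hy x hx⟩

lemma deltaI_zero_eq_sum {m n : ℕ} (A : Subgroup (Equiv.Perm (Fin m)))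
    (B : Subgroup (Equiv.Perm (Fin n))) [Fintype B] :
    deltaI A B 0 =
      (∑ b : B, propFix (A : Set (Equiv.Perm (Fin m))) 0 ^ fixCnt (b : Equiv.Perm (Fin n))) /
        Fintype.card B := by
  classical
  set A' : Finset (Equiv.Perm (Fin m)) := {a | a ∈ A} with hA'
  set D : Finset (Equiv.Perm (Fin m)) := {a ∈ A' | fixCnt a = 0} with hD
  set B' : Finset (Equiv.Perm (Fin n)) := {b | b ∈ B} with hB'
  have hA0 : (#A' : ℝ) ≠ 0 := by
    have : A'.Nonempty := ⟨1, by simp [hA', A.one_mem]⟩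
    exact_mod_cast this.card_ne_zero
  have hd : propFix (A : Set (Equiv.Perm (Fin m))) 0 = #D / #A' := by
    rw [propFix, propFixVia, ← Set.ncard_coe_finset, ← Set.ncard_coe_finset]
    simp [hD, hA']
  have hcard : Fintype.card B = #B' := Fintype.card_of_subtype B' (by simp [hB'])
  have hW : wreathSet A B =
      ((Fintype.piFinset (fun _ : Fin n => A') ×ˢ B' : Finset _) : Set _) := by
    ext p; simp [wreathSet, hA', hB']
  have hfib : ∀ b : Equiv.Perm (Fin n),
      ((#{α ∈ Fintype.piFinset (fun _ : Fin n => A') | fixCnt (imprimPerm α b) = 0} : ℕ) : ℝ) =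
        (#D / #A' : ℝ) ^ fixCnt b * (#A' : ℝ) ^ n := by
    intro b
    have : ({α ∈ Fintype.piFinset (fun _ : Fin n => A') | fixCnt (imprimPerm α b) = 0} : Finset _)
        = Fintype.piFinset (fun y : Fin n => if b y = y then D else A') := by
      ext α
      simp only [Finset.mem_filter, Fintype.mem_piFinset, fixCnt_imprimPerm_eq_zero_iff]
      rw [← forall_and]
      refine forall_congr' fun y => ?_
      by_cases h : b y = y <;> simp [h, hD]
    rw [this, Fintype.card_piFinset, fixCnt_eq_card]
    have hn : (#A' : ℝ) ^ n = ∏ _y : Fin n, (#A' : ℝ) := by simp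
    rw [hn, ← Finset.prod_const, Finset.prod_filter, ← Finset.prod_mul_distrib, Nat.cast_prod]
    refine Finset.prod_congr rfl fun y _ => ?_
    by_cases h : b y = y <;> simp [h, hA0]
  have hsum : ∑ b : B, (#D / #A' : ℝ) ^ fixCnt (b : Equiv.Perm (Fin n)) =
      ∑ b ∈ B', (#D / #A' : ℝ) ^ fixCnt b := by
    rw [Finset.sum_subtype B' (p := (· ∈ B)) (by simp [hB'])]
  have hnum : ({p ∈ wreathSet A B | fixCnt (imprimPerm p.1 p.2) = 0}) =
      (({p ∈ Fintype.piFinset (fun _ : Fin n => A') ×ˢ B' | fixCnt (imprimPerm p.1 p.2) = 0} :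
        Finset _) : Set _) := by
    rw [Finset.coe_filter]; simp_rw [hW]; rfl
  rw [deltaI, propFixVia, hnum, hW, Set.ncard_coe_finset, Set.ncard_coe_finset, hd, hcard, hsum,
    Finset.card_product, Finset.card_filter, Finset.sum_product_right]
  simp_rw [← Finset.card_filter]
  push_cast
  simp_rw [hfib, ← Finset.sum_mul]
  simp only [Fintype.card_piFinset, Finset.prod_const, Finset.card_univ, Fintype.card_fin]
  push_cast
  rw [mul_comm, mul_div_mul_left _ _ (pow_ne_zero _ hA0)]

lemma propFix_mem_Ico {m : ℕ} (hm : 1 ≤ m) (A : Subgroup (Equiv.Perm (Fin m))) :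
    propFix (A : Set (Equiv.Perm (Fin m))) 0 ∈ Set.Ico (0 : ℝ) 1 := by
  refine ⟨by unfold propFix propFixVia; positivity, ?_⟩
  have hlt : {a ∈ (A : Set (Equiv.Perm (Fin m))) | fixCnt (id a) = 0}.ncard <
      (A : Set (Equiv.Perm (Fin m))).ncard := by
    refine Set.ncard_lt_ncard ((Set.ssubset_iff_of_subset (Set.sep_subset _ _)).2
      ⟨1, A.one_mem, fun h => ?_⟩) (Set.toFinite _)
    exact (fixCnt_eq_zero_iff _).1 h.2 ⟨0, hm⟩ rfl
  rw [propFix, propFixVia, div_lt_one (by exact_mod_cast (Nat.zero_le _).trans_lt hlt)]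
  exact_mod_cast hlt

lemma sum_fixCnt_eq_card {X : Type*} [Finite X] [Nonempty X] (B : Subgroup (Equiv.Perm X))
    [Fintype B] [MulAction.IsPretransitive B X] :
    ∑ b : B, fixCnt (b : Equiv.Perm X) = Fintype.card B := by
  classical
  have := Fintype.ofFinite X
  have h := MulAction.sum_card_fixedBy_eq_card_orbits_mul_card_group B X
  have h1 : Fintype.card (Quotient (MulAction.orbitRel B X)) = 1 := by
    have := (MulAction.pretransitive_iff_subsingleton_quotient B X).1 inferInstance
    have : Nonempty (Quotient (MulAction.orbitRel B X)) := ⟨Quotient.mk _ (Classical.arbitrary X)⟩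
    exact le_antisymm (Fintype.card_le_one_iff_subsingleton.2 inferInstance) Fintype.card_pos
  rw [h1, one_mul] at h
  rw [← h]
  refine Finset.sum_congr rfl fun b _ => ?_
  rw [← Nat.card_eq_fintype_card, fixCnt]
  rfl

lemma le_deltaI {m n : ℕ} (hm : 1 ≤ m) (hn : 1 ≤ n) (A : Subgroup (Equiv.Perm (Fin m)))
    (B : Subgroup (Equiv.Perm (Fin n))) [MulAction.IsPretransitive B (Fin n)] :
    propFix (A : Set (Equiv.Perm (Fin m))) 0 ≤ deltaI A B 0 := by
  classical
  have : Fintype B := Fintype.ofFinite B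
  have : Nonempty (Fin n) := ⟨⟨0, hn⟩⟩
  obtain ⟨h0, -⟩ := propFix_mem_Ico hm A
  set d := propFix (A : Set (Equiv.Perm (Fin m))) 0
  have hB : (0 : ℝ) < Fintype.card B := by exact_mod_cast Fintype.card_pos
  rw [deltaI_zero_eq_sum, le_div_iff₀ hB]
  have hs : (∑ b : B, (fixCnt (b : Equiv.Perm (Fin n)) : ℝ)) = Fintype.card B := by
    exact_mod_cast sum_fixCnt_eq_card B
  calc d * Fintype.card B
      = ∑ b : B, (1 + (fixCnt (b : Equiv.Perm (Fin n)) : ℝ) * (d - 1)) := by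
        rw [Finset.sum_add_distrib, ← Finset.sum_mul, hs]; simp; ring
    _ ≤ _ := Finset.sum_le_sum fun b _ => by
        simpa using one_add_mul_le_pow (a := d - 1) (by linarith) (fixCnt (b : Equiv.Perm (Fin n)))

lemma deltaI_le_one {m n : ℕ} (A : Subgroup (Equiv.Perm (Fin m)))
    (B : Subgroup (Equiv.Perm (Fin n))) (k : ℕ) : deltaI A B k ≤ 1 := by
  refine div_le_one_of_le₀ ?_ (by positivity)
  exact_mod_cast Set.ncard_le_ncard (Set.sep_subset _ _) (Set.toFinite _)

lemma abs_deltaI_sub_le {m n p : ℕ} (hm : 1 ≤ m) (hn : 1 ≤ n) (hp : 0 < p)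
    (A : Subgroup (Equiv.Perm (Fin m))) (B : Subgroup (Equiv.Perm (Fin n)))
    [MulAction.IsPretransitive B (Fin n)] (hB : ∀ b ∈ B, fixCnt b ≤ 1 ∨ p ≤ fixCnt b) :
    |deltaI A B 0 - (1 - propFix (B : Set (Equiv.Perm (Fin n))) 1 *
      (1 - propFix (A : Set (Equiv.Perm (Fin m))) 0))| ≤ 1 / p := by
  classical
  have : Fintype B := Fintype.ofFinite B
  have : Nonempty (Fin n) := ⟨⟨0, hn⟩⟩
  obtain ⟨h0, h1⟩ := propFix_mem_Ico hm A
  rw [deltaI_zero_eq_sum]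
  set d := propFix (A : Set (Equiv.Perm (Fin m))) 0
  set f : B → ℕ := fun b => fixCnt (b : Equiv.Perm (Fin n)) with hf
  set N : ℝ := (Fintype.card B : ℝ) with hN
  have hNpos : (0 : ℝ) < N := by rw [hN]; exact_mod_cast Fintype.card_pos
  have hp' : (0 : ℝ) < p := by exact_mod_cast hp
  have hs : (∑ b : B, (f b : ℝ)) = N := by
    rw [hN, ← sum_fixCnt_eq_card B, Nat.cast_sum]
  have hr : propFix (B : Set (Equiv.Perm (Fin n))) 1 =
      (∑ b : B, if f b = 1 then (1 : ℝ) else 0) / N := by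
    have hset : {b ∈ (B : Set (Equiv.Perm (Fin n))) | fixCnt (id b) = 1} =
        Subtype.val '' ((({b : B | f b = 1} : Finset B)) : Set B) := by
      ext b; simp [hf, and_comm]
    have hcard : (B : Set (Equiv.Perm (Fin n))).ncard = Fintype.card B := by
      rw [← Nat.card_eq_fintype_card]; rfl
    rw [propFix, propFixVia, hset, Set.ncard_image_of_injective _ Subtype.val_injective,
      Set.ncard_coe_finset, hcard, Finset.sum_boole]
  have key : ∑ b : B, d ^ f b - (N - (∑ b : B, if f b = 1 then (1 : ℝ) else 0) * (1 - d)) =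
      -∑ b : B, ((1 - d ^ f b) - (if f b = 1 then (1 : ℝ) else 0) * (1 - d)) := by
    rw [Finset.sum_sub_distrib, Finset.sum_sub_distrib, ← Finset.sum_mul]
    simp [hN]
    ring
  have hterm : ∀ b : B, 0 ≤ (1 - d ^ f b) - (if f b = 1 then (1 : ℝ) else 0) * (1 - d) ∧
      (1 - d ^ f b) - (if f b = 1 then (1 : ℝ) else 0) * (1 - d) ≤ f b / p := by
    intro b
    rcases hB b b.2 with h | h
    · change f b ≤ 1 at h
      interval_cases hfb : f b
      · simp
      · simp
    · change p ≤ f b at h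
      by_cases hfb : f b = 1
      · rw [hfb]; simp
      · have hle : d ^ f b ≤ 1 := pow_le_one₀ h0 h1.le
        have hge : 0 ≤ d ^ f b := pow_nonneg h0 _
        have : (1 : ℝ) ≤ f b / p := by
          rw [le_div_iff₀ hp', one_mul]; exact_mod_cast h
        simp only [hfb, if_false, zero_mul, sub_zero]
        constructor <;> linarith
  have hdiv : (∑ b : B, d ^ f b) / N -
      (1 - (∑ b : B, if f b = 1 then (1 : ℝ) else 0) / N * (1 - d)) =
      (∑ b : B, d ^ f b - (N - (∑ b : B, if f b = 1 then (1 : ℝ) else 0) * (1 - d))) / N := by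
    field_simp
  rw [hr, hdiv, key, abs_div, abs_neg, abs_of_pos hNpos,
    abs_of_nonneg (Finset.sum_nonneg fun b _ => (hterm b).1), div_le_iff₀ hNpos]
  calc _ ≤ ∑ b : B, (f b : ℝ) / p := Finset.sum_le_sum fun b _ => (hterm b).2
    _ = 1 / p * N := by rw [← Finset.sum_div, hs]; ring

section Transport

variable {X Y : Type*} (e : X ≃ Y)

lemma fixCnt_permCongr (g : Equiv.Perm X) : fixCnt (e.permCongr g) = fixCnt g := by
  have : {y | e.permCongr g y = y} = e '' {x | g x = x} := by
    ext y
    obtain ⟨x, rfl⟩ := e.surjective y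
    simp
  rw [fixCnt, this, Set.ncard_image_of_injective _ e.injective, fixCnt]

lemma propFix_map_permCongrHom (B : Subgroup (Equiv.Perm X)) (k : ℕ) :
    propFix (B.map e.permCongrHom.toMonoidHom : Set (Equiv.Perm Y)) k =
      propFix (B : Set (Equiv.Perm X)) k := by
  have hset : {b ∈ (B.map e.permCongrHom.toMonoidHom : Set (Equiv.Perm Y)) | fixCnt (id b) = k} =
      e.permCongr '' {b ∈ (B : Set (Equiv.Perm X)) | fixCnt (id b) = k} := by
    ext g
    constructor
    · rintro ⟨⟨b, hb, rfl⟩, h⟩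
      exact ⟨b, ⟨hb, (fixCnt_permCongr e b).symm.trans h⟩, rfl⟩
    · rintro ⟨b, ⟨hb, h⟩, rfl⟩
      exact ⟨⟨b, hb, rfl⟩, (fixCnt_permCongr e b).trans h⟩
  rw [propFix, propFixVia, hset, Set.ncard_image_of_injective _ e.permCongr.injective,
    Subgroup.coe_map,
    Set.ncard_image_of_injective (f := e.permCongrHom.toMonoidHom) _ e.permCongrHom.injective]
  rfl

lemma IsImprimitiveSubgroup.map_permCongrHom {B : Subgroup (Equiv.Perm X)}
    (hB : IsImprimitiveSubgroup B) :
    IsImprimitiveSubgroup (B.map e.permCongrHom.toMonoidHom) := by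
  let φ := B.equivMapOfInjective e.permCongrHom.toMonoidHom e.permCongrHom.injective
  let j : X →ₑ[φ] Y := ⟨e, fun b x => by
    change e ((b : Equiv.Perm X) x) = e.permCongr b (e x)
    simp⟩
  refine ⟨MulAction.IsPretransitive.of_surjective_map (f := j) e.surjective hB.1,
    fun h => hB.2 ⟨hB.1, fun s hs => ?_⟩⟩
  rcases h.2 _ (hs.image j φ.surjective e.injective) with h | h
  · exact Or.inl (fun x hx y hy => e.injective
      (h (Set.mem_image_of_mem _ hx) (Set.mem_image_of_mem _ hy)))
  · exact Or.inr (Set.image_injective.2 e.injective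
      (h.trans (Set.image_univ_of_surjective e.surjective).symm))

end Transport

section Diagonal

variable {ι F : Type*} [Field F]

/-- The affine permutation `x ↦ (u i * x i + v i)_i` of `F^ι` with diagonal linear part. -/
def diagAffine (u : ι → Fˣ) (v : ι → F) : Equiv.Perm (ι → F) where
  toFun x i := u i * x i + v i
  invFun x i := (u i)⁻¹ * (x i - v i)
  left_inv x := by ext i; simp
  right_inv x := by ext i; simp

@[simp]
lemma diagAffine_apply (u : ι → Fˣ) (v x : ι → F) (i : ι) :
    diagAffine u v x i = u i * x i + v i := rfl

lemma diagAffine_injective {u u' : ι → Fˣ} {v v' : ι → F}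
    (h : diagAffine u v = diagAffine u' v') : u = u' ∧ v = v' := by
  have hv : v = v' := by
    ext i
    simpa using congrFun (congrArg (fun g => g 0) h) i
  refine ⟨?_, hv⟩
  ext i
  simpa [hv] using congrFun (congrArg (fun g => g 1) h) i

/-- The affine permutations of `F^ι` with diagonal linear part, the `i`-th diagonal entry
being taken from `H i`. -/
def diagAffineSubgroup (H : ι → Subgroup Fˣ) : Subgroup (Equiv.Perm (ι → F)) where
  carrier := {g | ∃ u v, (∀ i, u i ∈ H i) ∧ diagAffine u v = g}
  one_mem' := ⟨1, 0, fun i => (H i).one_mem, by ext; simp⟩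
  mul_mem' := by
    rintro _ _ ⟨u, v, hu, rfl⟩ ⟨u', v', hu', rfl⟩
    refine ⟨u * u', fun i => u i * v' i + v i, fun i => (H i).mul_mem (hu i) (hu' i), ?_⟩
    ext x i
    simp only [diagAffine_apply, Equiv.Perm.mul_apply, Pi.mul_apply, Units.val_mul]
    ring
  inv_mem' := by
    rintro _ ⟨u, v, hu, rfl⟩
    refine ⟨u⁻¹, fun i => -((u i)⁻¹ * v i), fun i => (H i).inv_mem (hu i), ?_⟩
    refine eq_inv_of_mul_eq_one_left ?_
    ext x i
    simp only [diagAffine_apply, Equiv.Perm.mul_apply, Pi.inv_apply, Equiv.Perm.one_apply]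
    simp [mul_add]

lemma mem_diagAffineSubgroup {H : ι → Subgroup Fˣ} {g : Equiv.Perm (ι → F)} :
    g ∈ diagAffineSubgroup H ↔ ∃ u v, (∀ i, u i ∈ H i) ∧ diagAffine u v = g := Iff.rfl

lemma fixCnt_diagAffine_of_forall_ne {u : ι → Fˣ} (v : ι → F) (hu : ∀ i, u i ≠ 1) :
    fixCnt (diagAffine u v) = 1 := by
  have hu' : ∀ i, (1 : F) - u i ≠ 0 := fun i h =>
    hu i (Units.ext (by simpa using (sub_eq_zero.1 h).symm))
  rw [fixCnt, Set.ncard_eq_one]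
  refine ⟨fun i => v i / (1 - u i), ?_⟩
  ext x
  simp only [Set.mem_ofPred_eq, Set.mem_singleton_iff, funext_iff, diagAffine_apply]
  refine forall_congr' fun i => ?_
  rw [eq_div_iff (hu' i)]
  constructor <;> intro h <;> linear_combination -h

lemma fixCnt_diagAffine_of_eq_one [Finite ι] [Finite F] {u : ι → Fˣ} (v : ι → F) {i : ι}
    (hu : u i = 1) : fixCnt (diagAffine u v) = 0 ∨ Nat.card F ≤ fixCnt (diagAffine u v) := by
  classical
  refine or_iff_not_imp_left.2 fun h => ?_
  rw [fixCnt_eq_zero_iff] at h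
  push Not at h
  obtain ⟨x, hx⟩ := h
  have hinj : Function.Injective (Function.update x i) := Function.update_injective x i
  rw [← Set.ncard_univ, ← Set.ncard_image_of_injective _ hinj, fixCnt]
  refine Set.ncard_le_ncard ?_ (Set.toFinite _)
  rintro _ ⟨c, -, rfl⟩
  ext k
  have hk := fun k => congrFun hx k
  simp only [diagAffine_apply] at hk ⊢
  by_cases hki : k = i
  · subst hki
    have := hk k
    simp only [hu, Units.val_one, one_mul, add_eq_left] at this
    simp [hu, this]
  · simpa [hki] using hk k

lemma fixCnt_diagAffine_eq_one_iff [Finite ι] [Finite F] (u : ι → Fˣ) (v : ι → F) :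
    fixCnt (diagAffine u v) = 1 ↔ ∀ i, u i ≠ 1 := by
  refine ⟨fun h i hi => ?_, fixCnt_diagAffine_of_forall_ne v⟩
  have := Finite.one_lt_card (α := F)
  rcases fixCnt_diagAffine_of_eq_one v hi with h' | h' <;> omega

lemma fixCnt_le_one_or_card_le [Finite ι] [Finite F] {H : ι → Subgroup Fˣ}
    {g : Equiv.Perm (ι → F)} (hg : g ∈ diagAffineSubgroup H) :
    fixCnt g ≤ 1 ∨ Nat.card F ≤ fixCnt g := by
  obtain ⟨u, v, -, rfl⟩ := hg
  by_cases h : ∀ i, u i ≠ 1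
  · exact Or.inl (fixCnt_diagAffine_of_forall_ne v h).le
  · push Not at h
    obtain ⟨i, hi⟩ := h
    exact (fixCnt_diagAffine_of_eq_one v hi).imp_left (fun h => by omega)

lemma propFix_diagAffineSubgroup [Fintype ι] [Finite F] (H : ι → Subgroup Fˣ) :
    propFix (diagAffineSubgroup H : Set (Equiv.Perm (ι → F))) 1 =
      ∏ i, ((Nat.card (H i) : ℝ) - 1) / Nat.card (H i) := by
  classical
  have : Fintype F := Fintype.ofFinite F
  have : ∀ i, Fintype (H i) := fun i => Fintype.ofFinite _
  let φ : ((i : ι) → H i) × (ι → F) → Equiv.Perm (ι → F) := fun w =>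
    diagAffine (fun i => w.1 i) w.2
  have hφ : Function.Injective φ := by
    rintro ⟨u, v⟩ ⟨u', v'⟩ h
    obtain ⟨hu, hv⟩ := diagAffine_injective h
    exact Prod.ext (funext fun i => Subtype.ext (congrFun hu i)) hv
  have hB : (diagAffineSubgroup H : Set (Equiv.Perm (ι → F))) =
      φ '' ((Finset.univ : Finset (((i : ι) → H i) × (ι → F))) : Set _) := by
    ext g
    simp only [SetLike.mem_coe, mem_diagAffineSubgroup, Finset.coe_univ, Set.image_univ,
      Set.mem_range]
    constructor
    · rintro ⟨u, v, hu, rfl⟩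
      exact ⟨⟨fun i => ⟨u i, hu i⟩, v⟩, rfl⟩
    · rintro ⟨w, rfl⟩
      exact ⟨_, _, fun i => (w.1 i).2, rfl⟩
  have hB1 : {g ∈ (diagAffineSubgroup H : Set (Equiv.Perm (ι → F))) | fixCnt (id g) = 1} =
      φ '' ((Fintype.piFinset (fun i => ({1}ᶜ : Finset (H i))) ×ˢ
        (Finset.univ : Finset (ι → F)) : Finset _) : Set _) := by
    rw [hB]
    ext g
    constructor
    · rintro ⟨⟨w, -, rfl⟩, h⟩
      have := (fixCnt_diagAffine_eq_one_iff _ _).1 h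
      exact ⟨w, by simpa using this, rfl⟩
    · rintro ⟨w, hw, rfl⟩
      refine ⟨⟨w, by simp, rfl⟩, (fixCnt_diagAffine_eq_one_iff _ _).2 ?_⟩
      simpa using hw
  rw [propFix, propFixVia, hB1, hB, Set.ncard_image_of_injective _ hφ,
    Set.ncard_image_of_injective _ hφ, Set.ncard_coe_finset, Set.ncard_coe_finset,
    Finset.card_product, ← Finset.univ_product_univ, Finset.card_product, Nat.cast_mul,
    Nat.cast_mul, mul_div_mul_right _ _ (by
      rw [Finset.card_univ]; exact_mod_cast Fintype.card_ne_zero),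
    Fintype.card_piFinset, Finset.card_univ, Fintype.card_pi, Nat.cast_prod, Nat.cast_prod,
    ← Finset.prod_div_distrib]
  refine Finset.prod_congr rfl fun i _ => ?_
  rw [Finset.card_compl, Finset.card_singleton, Nat.cast_sub Fintype.card_pos,
    Nat.card_eq_fintype_card, Nat.cast_one]

lemma isImprimitiveSubgroup_diagAffineSubgroup [Nontrivial ι] (H : ι → Subgroup Fˣ) :
    IsImprimitiveSubgroup (diagAffineSubgroup H) := by
  classical
  obtain ⟨i, j, hij⟩ := exists_pair_ne ι
  refine ⟨⟨fun x y => ⟨⟨diagAffine 1 (y - x), 1, y - x, fun i => (H i).one_mem, rfl⟩, ?_⟩⟩,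
    fun h => ?_⟩
  · change diagAffine 1 (y - x) x = y
    ext i
    simp
  · have hblock : MulAction.IsBlock (diagAffineSubgroup H) {x : ι → F | x i = 0} := by
      rw [MulAction.isBlock_iff_smul_eq_of_mem]
      rintro ⟨_, u, v, hu, rfl⟩ a ha hga
      have hv : v i = 0 := by
        change (u i : F) * a i + v i = 0 at hga
        rw [Set.mem_ofPred_eq] at ha
        simpa [ha] using hga
      ext y
      constructor
      · rintro ⟨x, hx, rfl⟩
        change (u i : F) * x i + v i = 0
        rw [Set.mem_ofPred_eq] at hx
        simp [hx, hv]
      · intro hy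
        refine ⟨(diagAffine u v).symm y, ?_, (diagAffine u v).apply_symm_apply y⟩
        change (((u i)⁻¹ : Fˣ) : F) * (y i - v i) = 0
        rw [Set.mem_ofPred_eq] at hy
        simp [hy, hv]
    rcases h.2 _ hblock with h | h
    · have := h (show (0 : ι → F) ∈ _ from rfl)
        (show Pi.single j (1 : F) ∈ _ from by simp [hij])
      simpa using congrFun this j
    · have : (1 : ι → F) ∈ {x : ι → F | x i = 0} := h ▸ Set.mem_univ _
      exact one_ne_zero this

end Diagonal

lemma exists_subgroup_units_zmod_card_eq {p k : ℕ} [Fact p.Prime] (hk : k ∣ p - 1) :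
    ∃ H : Subgroup (ZMod p)ˣ, Nat.card H = k :=
  ⟨(powMonoidHom k : (ZMod p)ˣ →* (ZMod p)ˣ).ker, by
    rw [IsCyclic.card_powMonoidHom_ker, Nat.card_eq_fintype_card, ZMod.card_units]
    exact Nat.gcd_eq_right hk⟩

lemma prod_add_div_add_succ (a s : ℕ) (hs : 0 < s) :
    ∏ i : Fin s, (((a + i + 1 : ℕ) : ℝ) - 1) / ((a + i + 1 : ℕ) : ℝ) = a / (a + s) := by
  rw [Fin.prod_univ_eq_prod_range
    (fun i => (((a + i + 1 : ℕ) : ℝ) - 1) / ((a + i + 1 : ℕ) : ℝ)) s]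
  induction s, hs using Nat.le_induction with
  | base => simp
  | succ s hs ih =>
    have : (a + s : ℝ) ≠ 0 := by positivity
    have : (a + s + 1 : ℝ) ≠ 0 := by positivity
    rw [Finset.prod_range_succ, ih]
    push_cast
    field_simp
    ring

/-- Every fraction `a / (a + s)` with `2 ≤ s` is, up to any prescribed error, the proportion
`r` for which some imprimitive `B` has `δ(A ≀_I B)` close to `1 - r * (1 - δ(A))`. -/
lemma exists_imprimitive_abs_deltaI_sub_le {m : ℕ} (hm : 1 ≤ m)
    (A : Subgroup (Equiv.Perm (Fin m))) (a : ℕ) {s : ℕ} (hs : 2 ≤ s) (q : ℕ) :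
    ∃ (n : ℕ) (B : Subgroup (Equiv.Perm (Fin n))), 1 ≤ n ∧ IsImprimitiveSubgroup B ∧
      |deltaI A B 0 - (1 - (a / (a + s) : ℝ) *
        (1 - propFix (A : Set (Equiv.Perm (Fin m))) 0))| ≤ 1 / (q + 1) := by
  obtain ⟨p, hp, hqp, hmod⟩ := Nat.exists_prime_gt_modEq_one q (Nat.factorial_ne_zero (a + s))
  have : Fact p.Prime := ⟨hp⟩
  have hdvd : (a + s).factorial ∣ p - 1 := (Nat.modEq_iff_dvd' hp.one_le).1 hmod.symm
  have hH : ∀ i : Fin s, ∃ H : Subgroup (ZMod p)ˣ, Nat.card H = a + i + 1 := fun i =>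
    exists_subgroup_units_zmod_card_eq
      ((Nat.dvd_factorial (Nat.succ_pos _) (by omega)).trans hdvd)
  choose H hHcard using hH
  have : Nontrivial (Fin s) := Fin.nontrivial_iff_two_le.2 hs
  let e := Fintype.equivFin (Fin s → ZMod p)
  have himp := (isImprimitiveSubgroup_diagAffineSubgroup H).map_permCongrHom e
  refine ⟨_, (diagAffineSubgroup H).map e.permCongrHom.toMonoidHom, Fintype.card_pos, himp, ?_⟩
  have := himp.1
  have hbound := abs_deltaI_sub_le hm Fintype.card_pos hp.pos A
    ((diagAffineSubgroup H).map e.permCongrHom.toMonoidHom) (by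
      rintro _ ⟨g, hg, rfl⟩
      have h := fixCnt_le_one_or_card_le hg
      rw [Nat.card_zmod] at h
      change fixCnt (e.permCongr g) ≤ 1 ∨ p ≤ fixCnt (e.permCongr g)
      rwa [fixCnt_permCongr])
  rw [propFix_map_permCongrHom, propFix_diagAffineSubgroup] at hbound
  simp_rw [hHcard] at hbound
  rw [prod_add_div_add_succ a s (by omega)] at hbound
  refine hbound.trans ?_
  have : (q + 1 : ℝ) ≤ p := by exact_mod_cast hqp
  gcongr

/-- **Theorem (density for imprimitive wreath products, varying imprimitive `B`).**
For fixed `A ≤ S_m`, the set `{δ(A ≀_I B) : B ≤ S_n imprimitive, n ∈ ℕ}`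
is dense in `[δ(A), 1]`. -/
theorem dense_delta_imprimitive_wreath_imprimitive_B (m : ℕ) (hm : 1 ≤ m)
    (A : Subgroup (Equiv.Perm (Fin m))) :
    {x : ℝ | ∃ (n : ℕ) (B : Subgroup (Equiv.Perm (Fin n))),
        1 ≤ n ∧ IsImprimitiveSubgroup B ∧ x = deltaI A B 0} ⊆
      Set.Icc (propFix (A : Set (Equiv.Perm (Fin m))) 0) 1 ∧
    Set.Icc (propFix (A : Set (Equiv.Perm (Fin m))) 0) 1 ⊆
      closure {x : ℝ | ∃ (n : ℕ) (B : Subgroup (Equiv.Perm (Fin n))),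
        1 ≤ n ∧ IsImprimitiveSubgroup B ∧ x = deltaI A B 0} := by
  obtain ⟨h0, h1⟩ := propFix_mem_Ico hm A
  constructor
  · rintro _ ⟨n, B, hn, hB, rfl⟩
    have := hB.1
    exact ⟨le_deltaI hm hn A B, deltaI_le_one A B 0⟩
  · rintro x ⟨hdx, hx1⟩
    rw [Metric.mem_closure_iff]
    intro ε hε
    set d := propFix (A : Set (Equiv.Perm (Fin m))) 0
    have ht : 0 < 1 - d := by linarith
    set ρ := (1 - x) / (1 - d) with hρ
    have hρ0 : 0 ≤ ρ := div_nonneg (by linarith) ht.le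
    have hρ1 : ρ ≤ 1 := (div_le_one ht).2 (by linarith)
    have hxρ : x = 1 - ρ * (1 - d) := by rw [hρ, div_mul_cancel₀ _ ht.ne']; ring
    obtain ⟨c, hc⟩ := exists_nat_gt (4 / ε)
    have hcpos : (0 : ℝ) < c := (by positivity : 0 < 4 / ε).trans hc
    set a := ⌊ρ * c⌋₊ with ha
    have hale : (a : ℝ) ≤ ρ * c := Nat.floor_le (by positivity)
    have hlt : ρ * c < a + 1 := Nat.lt_floor_add_one _
    have hac : a ≤ c := by
      have : (a : ℝ) ≤ c := hale.trans (by nlinarith)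
      exact_mod_cast this
    obtain ⟨n, B, hn, hB, hbound⟩ :=
      exists_imprimitive_abs_deltaI_sub_le hm A a (s := c - a + 2) (by omega) c
    refine ⟨_, ⟨n, B, hn, hB, rfl⟩, ?_⟩
    have hcast : (a : ℝ) + ((c - a + 2 : ℕ) : ℝ) = c + 2 := by
      push_cast [Nat.cast_sub hac]; ring
    rw [hcast] at hbound
    have hfrac : |a / (c + 2 : ℝ) - ρ| ≤ 3 / (c + 2) := by
      have : a / (c + 2 : ℝ) - ρ = (a - ρ * (c + 2)) / (c + 2) := by field_simp
      rw [this, abs_div, abs_of_pos (by positivity : (0 : ℝ) < c + 2)]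
      gcongr
      rw [abs_le]
      constructor <;> nlinarith
    have hclose : |(1 - (a / (c + 2) : ℝ) * (1 - d)) - x| ≤ 3 / (c + 2) := by
      have : (1 - (a / (c + 2) : ℝ) * (1 - d)) - x = -((a / (c + 2 : ℝ) - ρ) * (1 - d)) := by
        rw [hxρ]; ring
      rw [this, abs_neg, abs_mul, abs_of_pos ht]
      exact (mul_le_of_le_one_right (abs_nonneg _) (by linarith)).trans hfrac
    have h3 : 3 / (c + 2 : ℝ) ≤ 3 / c := by gcongr; linarith
    have h4 : 1 / (c + 1 : ℝ) ≤ 1 / c := by gcongr; linarith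
    have h5 : 4 / (c : ℝ) < ε := by
      rw [div_lt_iff₀ hcpos]; rw [div_lt_iff₀ hε] at hc; linarith
    have h6 : 3 / (c : ℝ) + 1 / c = 4 / c := by ring
    rw [dist_comm, Real.dist_eq]
    have := abs_sub_le (deltaI A B 0) (1 - (a / (c + 2) : ℝ) * (1 - d)) x
    linarith
end

section
/- Fix n ≥ 1 and a subgroup B ≤ S_n. The set of real numbers {δ(A≀_P B) : m ∈ ℕ, A ≤ S_m a primitive permutation group} is dense in the interval [0, 1]. -/
open Equiv Finset

/-- `(α, b)` has a fixed point in the power action. -/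
def HasFix {X Y : Type*} (b : Perm Y) (α : Y → Perm X) : Prop :=
  ∃ ω : Y → X, ∀ y, α y (ω y) = ω (b y)

/-- The number of elements of `A` having a fixed point. -/
noncomputable def fixingCard {X : Type*} (A : Subgroup (Perm X)) : ℕ :=
  Nat.card {a : A // ∃ x, (a : Perm X) x = x}

/-- The proportion of elements of `A` having a fixed point. -/
noncomputable def fixingProp {X : Type*} (A : Subgroup (Perm X)) : ℝ :=
  fixingCard A / Nat.card A

/-- The number of `α : Y → A` such that `(α, b)` has a fixed point in the power action. -/
noncomputable def fiberCard {X Y : Type*} (A : Subgroup (Perm X)) (b : Perm Y) : ℕ :=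
  Nat.card {α : Y → A // HasFix b (fun y => (α y : Perm X))}

theorem fixCnt_powerPerm_eq_zero_iff {X Y : Type*} [Finite X] [Finite Y]
    (α : Y → Perm X) (b : Perm Y) : fixCnt (powerPerm α b) = 0 ↔ ¬ HasFix b α := by
  rw [fixCnt, Set.ncard_eq_zero (Set.toFinite _), Set.eq_empty_iff_forall_notMem, HasFix,
    not_exists]
  refine forall_congr' fun ω => not_congr ?_
  simp only [Set.mem_ofPred_eq, powerPerm, Equiv.coe_fn_mk, funext_iff]
  rw [← b.forall_congr_right]
  simp

theorem fiberCard_permCongr {X Y Z : Type*} (A : Subgroup (Perm X)) (e : Y ≃ Z) (b : Perm Y) :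
    fiberCard A (e.permCongr b) = fiberCard A b := by
  refine (Nat.card_congr ((e.arrowCongr (Equiv.refl A)).subtypeEquiv fun α => ?_)).symm
  constructor
  · rintro ⟨ω, h⟩
    exact ⟨ω ∘ e.symm, fun z => by simpa using h (e.symm z)⟩
  · rintro ⟨ω, h⟩
    exact ⟨ω ∘ e, fun y => by simpa using h (e y)⟩

theorem fiberCard_of_isEmpty {X Y : Type*} [IsEmpty Y] (A : Subgroup (Perm X)) (b : Perm Y) :
    fiberCard A b = 1 := by
  rw [fiberCard, Nat.card_eq_one_iff_unique]
  exact ⟨inferInstance, ⟨⟨isEmptyElim, isEmptyElim, isEmptyElim⟩⟩⟩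

theorem fiberCard_option_of_eq {X Y : Type*} (A : Subgroup (Perm X)) (b : Perm (Option Y))
    (hb : b none = none) :
    fiberCard A b = fixingCard A * fiberCard A (removeNone b) := by
  rw [fiberCard, fiberCard, fixingCard, ← Nat.card_prod]
  have hs (y : Y) : some (removeNone b y) = b (some y) := by
    exact removeNone_some b (Option.ne_none_iff_exists'.1 fun h => by
      simpa using b.injective (h.trans hb.symm))
  refine Nat.card_congr ((Equiv.piOptionEquivProd.subtypeEquiv fun α => ?_).trans
    Equiv.subtypeProdEquivProd)
  constructor
  · rintro ⟨ω, h⟩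
    refine ⟨⟨ω none, by simpa [hb] using h none⟩, ω ∘ some, fun y => ?_⟩
    simpa [hs] using h (some y)
  · rintro ⟨⟨x, hx⟩, ω, h⟩
    refine ⟨fun o => o.elim x ω, fun o => ?_⟩
    cases o with
    | none => simpa [hb] using hx
    | some y => simpa [← hs] using h y

theorem fiberCard_option_of_ne {X Y : Type*} (A : Subgroup (Perm X))
    (b : Perm (Option Y)) (hb : b none ≠ none) :
    fiberCard A b = Nat.card A * fiberCard A (removeNone b) := by
  classical
  rw [fiberCard, fiberCard, ← Nat.card_congr (Equiv.subtypeUnivEquiv (p := fun _ : A => True)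
    fun _ => trivial), ← Nat.card_prod]
  let e : (Option Y → A) ≃ A × (Y → A) := Equiv.piOptionEquivProd.trans
    (Equiv.prodShear (Equiv.refl A) fun a => Equiv.piCongrRight fun y =>
      if b (some y) = none then Equiv.mulLeft a else Equiv.refl A)
  refine Nat.card_congr ((e.subtypeEquiv (q := fun p => True ∧
    HasFix (removeNone b) (fun y => (p.2 y : Perm X))) fun α => ?_).trans
    (Equiv.subtypeProdEquivProd (p := fun _ : A => True)
      (q := fun α : Y → A => HasFix (removeNone b) fun y => (α y : Perm X))))
  have he (y : Y) : ((e α).2 y : Perm X) =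
      if b (some y) = none then (α none : Perm X) * α (some y) else α (some y) := by
    by_cases h : b (some y) = none <;> simp [e, h, Equiv.piOptionEquivProd]
  have hr (y : Y) : some (removeNone b y) = if b (some y) = none then b none else b (some y) := by
    split_ifs with h
    · exact removeNone_none b h
    · exact removeNone_some b (Option.ne_none_iff_exists'.1 h)
  obtain ⟨o, ho⟩ := b.surjective none
  obtain ⟨y₀, rfl⟩ : ∃ y, o = some y := Option.ne_none_iff_exists'.1 (by rintro rfl; exact hb ho)
  simp only [true_and, HasFix, he]
  constructor
  · rintro ⟨ω, h⟩
    refine ⟨ω ∘ some, fun y => ?_⟩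
    rw [Function.comp_apply, Function.comp_apply, hr]
    split_ifs with hy
    · rw [Perm.mul_apply, h, hy, h]
    · exact h _
  · rintro ⟨ω, h⟩
    refine ⟨fun o => o.elim ((α (some y₀) : Perm X) (ω y₀)) ω, fun o => ?_⟩
    cases o with
    | none =>
      have := h y₀
      rw [if_pos ho, Perm.mul_apply] at this
      have h2 := hr y₀
      rw [if_pos ho] at h2
      rw [← h2]
      exact this
    | some y =>
      by_cases hy : b (some y) = none
      · obtain rfl : y = y₀ := by
          simpa using b.injective (hy.trans ho.symm)
        simp [hy]
      · have h1 := h y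
        have h2 := hr y
        rw [if_neg hy] at h1
        rw [if_neg hy] at h2
        rw [← h2]
        exact h1

theorem fixingCard_eq_fixingProp_mul {X : Type*} [Finite X] (A : Subgroup (Perm X)) :
    (fixingCard A : ℝ) = fixingProp A * Nat.card A := by
  rw [fixingProp, div_mul_cancel₀]
  exact_mod_cast Nat.card_pos.ne'

/-- The exponent is the number of cycles of `b`. -/
theorem exists_fiberCard_eq_pow {Y : Type} [Finite Y] (b : Perm Y) :
    ∃ c : ℕ, (Nonempty Y → c ≠ 0) ∧ ∀ (X : Type) [Finite X] (A : Subgroup (Perm X)),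
      (fiberCard A b : ℝ) = fixingProp A ^ c * (Nat.card A : ℝ) ^ Nat.card Y := by
  revert b
  induction Y using Finite.induction_empty_option with
  | of_equiv e ih =>
    intro b
    obtain ⟨c, hc, h⟩ := ih (e.symm.permCongr b)
    refine ⟨c, fun ⟨z⟩ => hc ⟨e.symm z⟩, fun X _ A => ?_⟩
    rw [← fiberCard_permCongr A e.symm b, h X A, Nat.card_congr e]
  | h_empty =>
    exact fun b => ⟨0, by simp, fun X _ A => by simp [fiberCard_of_isEmpty]⟩
  | h_option ih =>
    intro b
    obtain ⟨c, hc, h⟩ := ih (removeNone b)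
    by_cases hb : b none = none
    · refine ⟨c + 1, by simp, fun X _ A => ?_⟩
      rw [fiberCard_option_of_eq A b hb, Nat.cast_mul, h X A, fixingCard_eq_fixingProp_mul,
        Finite.card_option]
      ring
    · obtain ⟨y, hy⟩ := Option.ne_none_iff_exists'.1 hb
      refine ⟨c, fun _ => hc ⟨y⟩, fun X _ A => ?_⟩
      rw [fiberCard_option_of_ne A b hb, Nat.cast_mul, h X A, Finite.card_option]
      ring

theorem finsum_fiberCard {Y : Type} [Finite Y] {X : Type*} [Finite X] (A : Subgroup (Perm X)) :
    (∑ᶠ b : Perm Y, (fiberCard A b : ℝ)) = (∏ i ∈ range (Nat.card Y), (i + fixingProp A)) *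
      (Nat.card A : ℝ) ^ Nat.card Y := by
  classical
  induction Y using Finite.induction_empty_option with
  | of_equiv e ih =>
    rw [← Nat.card_congr e, ← ih]
    refine (finsum_eq_of_bijective e.permCongr e.permCongr.bijective fun b => ?_).symm
    rw [fiberCard_permCongr]
  | h_empty => simp [finsum_eq_sum_of_fintype, fiberCard_of_isEmpty]
  | @h_option Y _ ih =>
    have h (p : Option Y × Perm Y) : (fiberCard A (Perm.decomposeOption.symm p) : ℝ) =
        (p.1.elim (fixingCard A : ℝ) fun _ => Nat.card A) * fiberCard A p.2 := by
      obtain ⟨b, rfl⟩ := Perm.decomposeOption.surjective p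
      rw [Equiv.symm_apply_apply, Perm.decomposeOption_apply]
      dsimp only
      by_cases hb : b none = none
      · rw [fiberCard_option_of_eq A b hb, hb]
        simp
      · rw [fiberCard_option_of_ne A b hb]
        obtain ⟨y, hy⟩ := Option.ne_none_iff_exists'.1 hb
        simp [hy]
    rw [finsum_eq_sum_of_fintype] at ih ⊢
    rw [← Perm.decomposeOption.symm.sum_comp, Fintype.sum_prod_type]
    simp_rw [h, ← mul_sum, ih]
    rw [← sum_mul, Fintype.sum_option, Finite.card_option, prod_range_succ]
    simp only [Option.elim, sum_const, card_univ, nsmul_eq_mul, fixingCard_eq_fixingProp_mul,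
      Nat.card_eq_fintype_card]
    ring

/-- The pairs `(α, b)` forming the wreath product `A ≀ B`, over arbitrary index types. -/
def wreathPairs {X Y : Type*} (A : Subgroup (Perm X)) (B : Subgroup (Perm Y)) :
    Set ((Y → Perm X) × Perm Y) :=
  {p | (∀ y, p.1 y ∈ A) ∧ p.2 ∈ B}

theorem ncard_wreathPairs {X Y : Type*} [Finite Y] (A : Subgroup (Perm X))
    (B : Subgroup (Perm Y)) :
    (wreathPairs A B).ncard = Nat.card A ^ Nat.card Y * Nat.card B := by
  rw [← Nat.card_coe_set_eq, ← Nat.card_fun, ← Nat.card_prod]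
  exact Nat.card_congr
    { toFun p := (fun y => ⟨p.1.1 y, p.2.1 y⟩, ⟨p.1.2, p.2.2⟩)
      invFun p := ⟨(fun y => p.1 y, p.2), fun y => (p.1 y).2, p.2.2⟩
      left_inv _ := rfl
      right_inv _ := rfl }

theorem ncard_wreathPairs_hasFix {X Y : Type*} [Finite X] [Finite Y] (A : Subgroup (Perm X))
    (B : Subgroup (Perm Y)) :
    {p ∈ wreathPairs A B | HasFix p.2 p.1}.ncard = ∑ᶠ b : B, fiberCard A (b : Perm Y) := by
  have := Fintype.ofFinite B
  rw [finsum_eq_sum_of_fintype, ← Nat.card_coe_set_eq]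
  simp only [fiberCard]
  rw [← Nat.card_sigma]
  exact Nat.card_congr
    { toFun p := ⟨⟨p.1.2, p.2.1.2⟩, fun y => ⟨p.1.1 y, p.2.1.1 y⟩, p.2.2⟩
      invFun p := ⟨(fun y => p.2.1 y, p.1), ⟨fun y => (p.2.1 y).2, p.1.2⟩, p.2.2⟩
      left_inv _ := rfl
      right_inv _ := rfl }

theorem deltaP_zero_eq {m n : ℕ} (A : Subgroup (Perm (Fin m))) (B : Subgroup (Perm (Fin n))) :
    deltaP A B 0 = 1 - (∑ᶠ b : B, (fiberCard A (b : Perm (Fin n)) : ℝ)) /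
      ((Nat.card A : ℝ) ^ n * Nat.card B) := by
  have := Fintype.ofFinite B
  have hW : wreathSet A B = wreathPairs A B := rfl
  have hd : {p ∈ wreathSet A B | fixCnt (powerPerm p.1 p.2) = 0} =
      wreathPairs A B \ {p ∈ wreathPairs A B | HasFix p.2 p.1} := by
    ext p
    simp only [Set.mem_ofPred_eq, fixCnt_powerPerm_eq_zero_iff, Set.mem_sdiff, hW]
    tauto
  have hsub : {p ∈ wreathPairs A B | HasFix p.2 p.1} ⊆ wreathPairs A B := Set.sep_subset _ _
  have hcard := Set.ncard_sdiff_add_ncard_of_subset hsub (Set.toFinite _)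
  rw [ncard_wreathPairs_hasFix, finsum_eq_sum_of_fintype, ncard_wreathPairs,
    Nat.card_fin] at hcard
  have hcard' : (((wreathPairs A B \ {p ∈ wreathPairs A B | HasFix p.2 p.1}).ncard : ℕ) : ℝ) +
      ∑ b : B, (fiberCard A (b : Perm (Fin n)) : ℝ) = (Nat.card A : ℝ) ^ n * Nat.card B := by
    exact_mod_cast hcard
  have hA : (Nat.card A : ℝ) ≠ 0 := by exact_mod_cast Nat.card_pos.ne'
  have hB : (Nat.card B : ℝ) ≠ 0 := by exact_mod_cast Nat.card_pos.ne'
  rw [deltaP, propFixVia, hd, hW, ncard_wreathPairs, Nat.card_fin, finsum_eq_sum_of_fintype,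
    eq_sub_of_add_eq hcard']
  push_cast
  rw [sub_div, div_self (by positivity)]

/-- The derangement proportion of `A ≀_P B` is a continuous function of the proportion of
elements of `A` with a fixed point. -/
theorem exists_continuous_deltaP_zero_eq {n : ℕ} (hn : 1 ≤ n) (B : Subgroup (Perm (Fin n))) :
    ∃ F : ℝ → ℝ, Continuous F ∧ F 0 = 1 ∧ F 1 = 0 ∧
      ∀ (m : ℕ) (A : Subgroup (Perm (Fin m))), deltaP A B 0 = F (fixingProp A) := by
  have := Fintype.ofFinite B
  have : Nonempty (Fin n) := ⟨⟨0, hn⟩⟩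
  choose c hc h using fun b : B => exists_fiberCard_eq_pow (b : Perm (Fin n))
  have hB : (Nat.card B : ℝ) ≠ 0 := by exact_mod_cast Nat.card_pos.ne'
  refine ⟨fun x => 1 - (∑ b : B, x ^ c b) / Nat.card B, by fun_prop, ?_, ?_, fun m A => ?_⟩
  · simp [zero_pow (hc _ this)]
  · simp only [one_pow, sum_const, card_univ, nsmul_eq_mul, mul_one, ← Nat.card_eq_fintype_card]
    rw [div_self hB, sub_self]
  · have hA : (Nat.card A : ℝ) ≠ 0 := by exact_mod_cast Nat.card_pos.ne'
    rw [deltaP_zero_eq, finsum_eq_sum_of_fintype]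
    simp_rw [h _ (Fin m) A, ← sum_mul, Nat.card_fin]
    field_simp

/-- The power wreath product `A ≀_P Sym(Y)` as a permutation group on `Y → X`. -/
def powerGroup {X : Type*} (Y : Type*) (A : Subgroup (Perm X)) : Subgroup (Perm (Y → X)) where
  carrier := {g | ∃ p ∈ wreathPairs A (⊤ : Subgroup (Perm Y)), powerPerm p.1 p.2 = g}
  mul_mem' := by
    rintro _ _ ⟨⟨α, b⟩, ⟨hα, -⟩, rfl⟩ ⟨⟨β, c⟩, ⟨hβ, -⟩, rfl⟩
    refine ⟨(fun y => α (c y) * β y, b * c), ⟨fun y => A.mul_mem (hα _) (hβ _), trivial⟩, ?_⟩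
    ext ω y
    simp [powerPerm]
  one_mem' := ⟨(1, 1), ⟨fun _ => A.one_mem, trivial⟩, by ext ω y; simp [powerPerm]⟩
  inv_mem' := by
    rintro _ ⟨⟨α, b⟩, ⟨hα, -⟩, rfl⟩
    refine ⟨(fun y => (α (b⁻¹ y))⁻¹, b⁻¹), ⟨fun y => A.inv_mem (hα _), trivial⟩, ?_⟩
    refine eq_inv_of_mul_eq_one_left ?_
    ext ω y
    simp [powerPerm]

theorem powerPerm_injective {X Y : Type*} [Nontrivial X] :
    Function.Injective fun p : (Y → Perm X) × Perm Y => powerPerm p.1 p.2 := by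
  classical
  rintro ⟨α, b⟩ ⟨β, c⟩ h
  have h' (ω : Y → X) (y : Y) : α (b⁻¹ y) (ω (b⁻¹ y)) = β (c⁻¹ y) (ω (c⁻¹ y)) :=
    congrFun (congrArg (fun g : Perm (Y → X) => g ω) h) y
  have hbc : b⁻¹ = c⁻¹ := by
    ext y
    by_contra hne
    obtain ⟨u, v, huv⟩ := exists_pair_ne X
    have h1 := h' (fun _ => u) y
    have h2 := h' (Function.update (fun _ => u) (b⁻¹ y) v) y
    rw [Function.update_self, Function.update_of_ne (Ne.symm hne), ← h1] at h2
    exact huv ((α _).injective h2.symm)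
  obtain rfl := inv_injective hbc
  refine Prod.ext (funext fun y => Equiv.ext fun x => ?_) rfl
  simpa using h' (fun _ => x) (b y)

theorem fixingProp_powerGroup {X Y : Type} [Finite X] [Nontrivial X] [Finite Y]
    (A : Subgroup (Perm X)) :
    fixingProp (powerGroup Y A) =
      ∏ i ∈ range (Nat.card Y), ((i + fixingProp A) / (i + 1)) := by
  have hcard : Nat.card (powerGroup Y A) = (wreathPairs A (⊤ : Subgroup (Perm Y))).ncard := by
    rw [← Set.ncard_image_of_injective _ powerPerm_injective, ← Nat.card_coe_set_eq]
    rfl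
  have hfix : fixingCard (powerGroup Y A) =
      {p ∈ wreathPairs A (⊤ : Subgroup (Perm Y)) | HasFix p.2 p.1}.ncard := by
    rw [← Set.ncard_image_of_injective _ powerPerm_injective, ← Nat.card_coe_set_eq, fixingCard]
    refine Nat.card_congr ((Equiv.subtypeSubtypeEquivSubtypeInter
      (fun g => g ∈ powerGroup Y A) fun g => ∃ ω, g ω = ω).trans
      (Equiv.subtypeEquivRight fun g => ?_))
    have key (p : (Y → Perm X) × Perm Y) : (∃ ω, powerPerm p.1 p.2 ω = ω) ↔ HasFix p.2 p.1 := by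
      rw [← not_iff_not, ← fixCnt_powerPerm_eq_zero_iff, fixCnt,
        Set.ncard_eq_zero (Set.toFinite _), Set.eq_empty_iff_forall_notMem, not_exists]
      rfl
    constructor
    · rintro ⟨⟨p, hp, rfl⟩, hω⟩
      exact ⟨p, ⟨hp, (key p).1 hω⟩, rfl⟩
    · rintro ⟨p, ⟨hp, hω⟩, rfl⟩
      exact ⟨⟨p, hp, rfl⟩, (key p).2 hω⟩
  have hsum : (∑ᶠ b : (⊤ : Subgroup (Perm Y)), (fiberCard A (b : Perm Y) : ℝ)) =
      ∑ᶠ b : Perm Y, (fiberCard A b : ℝ) :=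
    finsum_eq_of_bijective _ Subgroup.topEquiv.bijective fun _ => rfl
  have hcast : ((∑ᶠ b : (⊤ : Subgroup (Perm Y)), fiberCard A (b : Perm Y) : ℕ) : ℝ) =
      ∑ᶠ b : (⊤ : Subgroup (Perm Y)), (fiberCard A (b : Perm Y) : ℝ) :=
    (Nat.castAddMonoidHom ℝ).map_finsum (Set.toFinite _)
  have hA : (Nat.card A : ℝ) ≠ 0 := by exact_mod_cast Nat.card_pos.ne'
  rw [fixingProp, hfix, hcard, ncard_wreathPairs_hasFix, hcast, hsum, finsum_fiberCard,
    ncard_wreathPairs, Subgroup.card_top, Nat.card_perm, prod_div_distrib]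
  push_cast
  rw [mul_comm ((Nat.card A : ℝ) ^ _), mul_div_mul_right _ _ (by positivity),
    ← Finset.prod_range_add_one_eq_factorial]
  push_cast
  rfl

/-- A criterion for primitivity phrased through elements. -/
def IsPrimitiveOn {X : Type*} (A : Subgroup (Perm X)) : Prop :=
  (∀ x y, ∃ a ∈ A, a x = y) ∧
  ∀ s : Set X, (∀ a ∈ A, ∀ x ∈ s, a x ∈ s → ∀ y ∈ s, a y ∈ s) → s.Subsingleton ∨ s = Set.univ

theorem IsPrimitiveOn.isPrimitiveSubgroup {X : Type*} {A : Subgroup (Perm X)}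
    (h : IsPrimitiveOn A) : IsPrimitiveSubgroup A := by
  refine ⟨⟨fun x y => ?_⟩, fun s hs => h.2 s fun a ha x hx hax y hy => ?_⟩
  · obtain ⟨a, ha, hxy⟩ := h.1 x y
    exact ⟨⟨a, ha⟩, hxy⟩
  · have := MulAction.isBlock_iff_smul_eq_of_mem.1 hs (g := (⟨a, ha⟩ : A)) hx hax
    rw [← this]
    exact Set.smul_mem_smul_set hy

theorem IsPrimitiveOn.map_permCongr {X Z : Type*} {A : Subgroup (Perm X)}
    (h : IsPrimitiveOn A) (e : X ≃ Z) : IsPrimitiveOn (A.map e.permCongrHom.toMonoidHom) := by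
  refine ⟨fun x y => ?_, fun s hs => ?_⟩
  · obtain ⟨a, ha, hxy⟩ := h.1 (e.symm x) (e.symm y)
    exact ⟨_, Subgroup.mem_map_of_mem _ ha, by simp [hxy]⟩
  · have := h.2 (e ⁻¹' s) fun a ha x hx hax y hy => by
      simpa using hs _ (Subgroup.mem_map_of_mem e.permCongrHom.toMonoidHom ha) (e x) hx
        (by simpa using hax) (e y) hy
    refine this.imp (fun hsub => ?_) fun huniv => ?_
    · intro x hx y hy
      exact e.symm.injective (hsub (by simpa using hx) (by simpa using hy))
    · rw [← Set.image_preimage_eq s e.surjective, huniv, Set.image_univ, e.range_eq_univ]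

theorem fixingProp_map_permCongr {X Z : Type*} (A : Subgroup (Perm X)) (e : X ≃ Z) :
    fixingProp (A.map e.permCongrHom.toMonoidHom) = fixingProp A := by
  let E := A.equivMapOfInjective e.permCongrHom.toMonoidHom e.permCongrHom.injective
  have hfix : fixingCard A = fixingCard (A.map e.permCongrHom.toMonoidHom) := by
    refine Nat.card_congr (E.toEquiv.subtypeEquiv fun a => ?_)
    have hE (z : Z) : (E a : Perm Z) z = e ((a : Perm X) (e.symm z)) := rfl
    constructor
    · rintro ⟨x, hx⟩
      exact ⟨e x, (hE _).trans (by rw [e.symm_apply_apply, hx])⟩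
    · rintro ⟨z, hz⟩
      exact ⟨e.symm z, e.injective (by rw [← hE, e.apply_symm_apply]; exact hz)⟩
  rw [fixingProp, fixingProp, hfix, Nat.card_congr E.toEquiv]

theorem Set.eq_univ_of_update_mem {X Y : Type*} [Finite Y] [DecidableEq Y] {s : Set (Y → X)}
    (hne : s.Nonempty) (h : ∀ ω ∈ s, ∀ y x, Function.update ω y x ∈ s) : s = Set.univ := by
  have := Fintype.ofFinite Y
  obtain ⟨ω, hω⟩ := hne
  refine Set.eq_univ_of_forall fun ω' => ?_
  have key (t : Finset Y) : t.piecewise ω' ω ∈ s := by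
    induction t using Finset.induction_on with
    | empty => simpa using hω
    | insert y t _ ih =>
      rw [Finset.piecewise_insert]
      exact h _ ih _ _
  simpa using key Finset.univ

theorem exists_mem_powerGroup_update {X Y : Type*} [DecidableEq Y] {A : Subgroup (Perm X)}
    {a : Perm X} (ha : a ∈ A) (y : Y) :
    ∃ g ∈ powerGroup Y A, ∀ ω, g ω = Function.update ω y (a (ω y)) := by
  refine ⟨_, ⟨(Function.update 1 y a, 1), ⟨fun z => ?_, trivial⟩, rfl⟩, fun ω => ?_⟩
  · by_cases h : z = y
    · subst h; simpa using ha
    · simp [h]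
  · ext z
    change Function.update (1 : Y → Perm X) y a ((1 : Perm Y)⁻¹ z) (ω ((1 : Perm Y)⁻¹ z)) = _
    rw [inv_one, Perm.one_apply]
    by_cases h : z = y
    · subst h; simp
    · simp [h]

theorem exists_mem_powerGroup_comp {X Y : Type*} (A : Subgroup (Perm X)) (b : Perm Y) :
    ∃ g ∈ powerGroup Y A, ∀ ω, g ω = ω ∘ b.symm :=
  ⟨_, ⟨(1, b), ⟨fun _ => A.one_mem, trivial⟩, rfl⟩, fun ω => by ext y; simp [powerPerm]⟩

/-- The power wreath product of a doubly transitive group of degree at least three with a full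
symmetric group is primitive. -/
theorem isPrimitiveOn_powerGroup {X Y : Type*} [Finite Y] {A : Subgroup (Perm X)}
    (htrans : ∀ x y, ∃ a ∈ A, a x = y)
    (hstab : ∀ x y z, y ≠ x → z ≠ x → ∃ a ∈ A, a x = x ∧ a y = z)
    (hthree : ∀ x y : X, ∃ z, z ≠ x ∧ z ≠ y) : IsPrimitiveOn (powerGroup Y A) := by
  classical
  constructor
  · intro ω ω'
    choose α hα h using fun y => htrans (ω y) (ω' y)
    exact ⟨_, ⟨(α, 1), ⟨hα, trivial⟩, rfl⟩, by ext y; simp [powerPerm, h]⟩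
  intro s hs
  refine or_iff_not_imp_left.2 fun hsub => ?_
  obtain ⟨ω₀, h₀, ω₁, h₁, hne⟩ := Set.not_subsingleton_iff.1 hsub
  obtain ⟨y, hy⟩ := Function.ne_iff.1 hne
  have hupd (ω : Y → X) (hω : ω ∈ s) (z : Y) (a : Perm X) (ha : a ∈ A) (haω : a (ω z) = ω z)
      (ω' : Y → X) (hω' : ω' ∈ s) : Function.update ω' z (a (ω' z)) ∈ s := by
    obtain ⟨g, hg, hgω⟩ := exists_mem_powerGroup_update ha z
    rw [← hgω]
    exact hs g hg ω hω (by rwa [hgω, haω, Function.update_eq_self]) ω' hω'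
  obtain ⟨x, hx₀, hx₁⟩ := hthree (ω₀ y) (ω₁ y)
  have hv : Function.update ω₁ y x ∈ s := by
    obtain ⟨a, ha, hfix, rfl⟩ := hstab (ω₀ y) (ω₁ y) x hy.symm hx₀
    exact hupd ω₀ h₀ y a ha hfix ω₁ h₁
  have hline (w : X) : Function.update ω₁ y w ∈ s := by
    by_cases hw : w = ω₁ y
    · rwa [hw, Function.update_eq_self]
    · obtain ⟨a, ha, hfix, hxw⟩ := hstab (ω₁ y) x w hx₁ hw
      simpa [hxw] using hupd ω₁ h₁ y a ha hfix _ hv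
  have hstable (ω : Y → X) (hω : ω ∈ s) (w : X) : Function.update ω y w ∈ s := by
    obtain ⟨a, ha, haw⟩ := htrans (ω y) w
    obtain ⟨g, hg, hgω⟩ := exists_mem_powerGroup_update ha y
    rw [← haw, ← hgω]
    exact hs g hg ω₁ h₁ (by rw [hgω]; exact hline _) ω hω
  have hswap (z : Y) (ω : Y → X) (hω : ω ∈ s) : ω ∘ swap y z ∈ s := by
    obtain ⟨g, hg, hgω⟩ := exists_mem_powerGroup_comp A (swap y z)
    have := hs g hg _ (hstable ω hω (ω z)) ?_ ω hω
    · simpa [hgω] using this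
    · rw [hgω]
      convert hstable ω hω (ω z) using 1
      ext u
      simp only [symm_swap, Function.comp_apply, swap_apply_def, Function.update_apply]
      split_ifs <;> simp_all
  refine Set.eq_univ_of_update_mem ⟨ω₀, h₀⟩ fun ω hω z w => ?_
  convert hswap z _ (hstable _ (hswap z ω hω) w) using 1
  ext u
  simp only [Function.comp_apply, swap_apply_def, Function.update_apply]
  split_ifs <;> simp_all

/-- The group of affine transformations `x ↦ u * x + c` of a field. -/
def affineGroup (F : Type*) [Field F] : Subgroup (Perm F) where
  carrier := {g | ∃ (u : Fˣ) (c : F), ∀ x, g x = u * x + c}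
  mul_mem' := by
    rintro g h ⟨u, c, hg⟩ ⟨v, d, hh⟩
    refine ⟨u * v, u * d + c, fun x => ?_⟩
    rw [Perm.mul_apply, hh, hg]
    push_cast
    ring
  one_mem' := ⟨1, 0, by simp⟩
  inv_mem' := by
    rintro g ⟨u, c, hg⟩
    refine ⟨u⁻¹, -(u⁻¹ * c : F), fun x => ?_⟩
    rw [Perm.inv_eq_iff_eq, hg, mul_add, mul_neg, u.mul_inv_cancel_left, u.mul_inv_cancel_left,
      neg_add_cancel_right]

/-- Affine transformations are parametrized by slope and intercept. -/
noncomputable def affineGroupEquiv (F : Type*) [Field F] : Fˣ × F ≃ affineGroup F :=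
  Equiv.ofBijective
    (fun p => ⟨(Units.mulLeft p.1).trans (Equiv.addRight p.2), p.1, p.2, fun _ => rfl⟩) <| by
    constructor
    · rintro ⟨u, c⟩ ⟨v, d⟩ h
      have h' (x : F) : (u : F) * x + c = v * x + d :=
        congrArg (fun g : affineGroup F => (g : Perm F) x) h
      have h0 := h' 0
      have h1 := h' 1
      simp only [mul_zero, zero_add, mul_one] at h0 h1
      subst h0
      exact Prod.ext (Units.ext (add_right_cancel h1)) rfl
    · rintro ⟨g, u, c, hg⟩
      exact ⟨(u, c), Subtype.ext (Equiv.ext fun x => (hg x).symm)⟩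

theorem affineGroup_stabilizer {F : Type*} [Field F] (x y z : F) (hy : y ≠ x) (hz : z ≠ x) :
    ∃ a ∈ affineGroup F, a x = x ∧ a y = z := by
  have hy' := sub_ne_zero.2 hy
  let u : Fˣ := Units.mk0 ((z - x) / (y - x)) (div_ne_zero (sub_ne_zero.2 hz) hy')
  refine ⟨_, (affineGroupEquiv F (u, x - u * x)).2, ?_, ?_⟩
  · change (u : F) * x + (x - u * x) = x
    ring
  · change (z - x) / (y - x) * y + (x - (z - x) / (y - x) * x) = z
    field_simp
    ring

theorem affineGroup_transitive {F : Type*} [Field F] (x y : F) : ∃ a ∈ affineGroup F, a x = y := by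
  refine ⟨_, (affineGroupEquiv F (1, y - x)).2, ?_⟩
  change ((1 : Fˣ) : F) * x + (y - x) = y
  simp

theorem fixingProp_affineGroup (F : Type*) [Field F] [Fintype F] :
    fixingProp (affineGroup F) = 1 - 1 / Fintype.card F := by
  classical
  have hfix : fixingCard (affineGroup F) = Fintype.card {p : Fˣ × F // ¬ (p.1 = 1 ∧ p.2 ≠ 0)} := by
    rw [← Nat.card_eq_fintype_card]
    refine (Nat.card_congr ((affineGroupEquiv F).subtypeEquiv fun p => ?_)).symm
    change _ ↔ ∃ x, (p.1 : F) * x + p.2 = x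
    by_cases hu : p.1 = 1
    · simp [hu]
    · have hu' : (1 : F) - p.1 ≠ 0 := sub_ne_zero.2 fun h => hu (Units.ext h.symm)
      simp only [hu, false_and, not_false_eq_true, true_iff]
      refine ⟨p.2 / (1 - p.1), ?_⟩
      field_simp
      ring
  have hder : Fintype.card {p : Fˣ × F // p.1 = 1 ∧ p.2 ≠ 0} = Fintype.card F - 1 := by
    rw [Fintype.card_congr (Equiv.subtypeProdEquivProd (p := fun u : Fˣ => u = 1)
      (q := fun c : F => ¬ c = 0)), Fintype.card_prod, Fintype.card_subtype_eq,
      one_mul, Fintype.card_subtype_compl, Fintype.card_subtype_eq]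
  have hq : 1 < Fintype.card F := Fintype.one_lt_card
  have hcompl := Fintype.card_subtype_compl (fun p : Fˣ × F => p.1 = 1 ∧ p.2 ≠ 0)
  rw [hder, Fintype.card_prod, Fintype.card_units] at hcompl
  rw [fixingProp, hfix, ← Nat.card_congr (affineGroupEquiv F), Nat.card_prod,
    Nat.card_eq_fintype_card, Nat.card_eq_fintype_card, Fintype.card_units, hcompl]
  obtain ⟨k, hk⟩ : ∃ k, Fintype.card F = k + 1 + 1 := 
    ⟨Fintype.card F - 2, by omega⟩
  rw [hk]
  have : (k + 1 + 1 - 1) * (k + 1 + 1) - (k + 1 + 1 - 1) = (k + 1) * (k + 1) := by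
    simp only [Nat.add_sub_cancel]
    rw [mul_add_one (k + 1) (k + 1), Nat.add_sub_cancel]
  rw [this]
  push_cast [Nat.add_sub_cancel]
  field_simp
  ring

/-- For `0 ≤ q < 1` the products `∏ (i + q) / (i + 1)` decrease to `0` with steps at most
`1 - q`. -/
theorem exists_prod_near {q t : ℝ} (hq0 : 0 ≤ q) (hq1 : q < 1) (ht0 : 0 < t) (ht1 : t ≤ 1) :
    ∃ N : ℕ, |∏ i ∈ range N, ((i + q) / (i + 1) : ℝ) - t| ≤ 1 - q := by
  set a : ℕ → ℝ := fun N => ∏ i ∈ range N, ((i + q) / (i + 1) : ℝ) with ha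
  have hle (N : ℕ) : a N ≤ Real.exp (-(1 - q) * ∑ i ∈ range N, (1 / ((i : ℝ) + 1))) := by
    rw [mul_sum, Real.exp_sum]
    refine prod_le_prod (fun i _ => by positivity) fun i _ => ?_
    refine le_trans (le_of_eq ?_) (Real.add_one_le_exp _)
    field_simp
    ring
  have hlim : Filter.Tendsto a Filter.atTop (nhds 0) := by
    refine squeeze_zero (fun N => prod_nonneg fun i _ => by positivity) hle ?_
    refine Real.tendsto_exp_atBot.comp ?_
    exact Real.tendsto_sum_range_one_div_nat_succ_atTop.const_mul_atTop_of_neg (by linarith)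
  have hex : ∃ N, a N < t := (hlim.eventually_lt_const ht0).exists
  classical
  obtain ⟨M, hM⟩ : ∃ M, Nat.find hex = M + 1 := by
    refine Nat.exists_eq_succ_of_ne_zero fun h => ?_
    have := Nat.find_spec hex
    rw [h] at this
    simp only [ha, range_zero, prod_empty] at this
    linarith
  have hlt := Nat.find_spec hex
  have hge : t ≤ a M := not_lt.1 (Nat.find_min hex (by omega))
  rw [hM] at hlt
  have hone : a M ≤ 1 := prod_le_one (fun i _ => by positivity) fun i _ => by
    rw [div_le_one (by positivity)]; linarith
  have hstep : a M - a (M + 1) ≤ 1 - q := by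
    have : a (M + 1) = a M * ((M + q) / (M + 1)) := prod_range_succ _ _
    have h2 : a M - a (M + 1) = a M * ((1 - q) / (M + 1)) := by
      rw [this]; field_simp; ring
    rw [h2]
    calc a M * ((1 - q) / (M + 1)) ≤ 1 * (1 - q) := by
          refine mul_le_mul hone (div_le_self (by linarith) (by simp)) ?_ zero_le_one
          exact div_nonneg (by linarith) (by positivity)
      _ = 1 - q := one_mul _
  exact ⟨M + 1, by rw [abs_le]; constructor <;> linarith⟩

/-- The proportions of elements with a fixed point in primitive groups are dense in `[0, 1]`. -/
theorem mem_closure_fixingProp {t : ℝ} (ht : t ∈ Set.Icc (0 : ℝ) 1) :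
    t ∈ closure {x : ℝ | ∃ (m : ℕ) (A : Subgroup (Perm (Fin m))),
      1 ≤ m ∧ IsPrimitiveSubgroup A ∧ x = fixingProp A} := by
  have hIoc : Set.Ioc (0 : ℝ) 1 ⊆ closure {x : ℝ | ∃ (m : ℕ) (A : Subgroup (Perm (Fin m))),
      1 ≤ m ∧ IsPrimitiveSubgroup A ∧ x = fixingProp A} := by
    intro t ht
    refine Metric.mem_closure_iff.2 fun ε hε => ?_
    obtain ⟨k, hk⟩ := exists_nat_gt (1 / ε)
    obtain ⟨p, hpk, hp⟩ := Nat.exists_infinite_primes (k + 3)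
    have : Fact p.Prime := ⟨hp⟩
    have hcard : Fintype.card (ZMod p) = p := ZMod.card p
    have hp0 : (0 : ℝ) < p := by exact_mod_cast hp.pos
    have hq : fixingProp (affineGroup (ZMod p)) = 1 - 1 / p := by
      rw [fixingProp_affineGroup, hcard]
    have hp1 : (1 : ℝ) / p ≤ 1 := (div_le_one hp0).2 (by exact_mod_cast hp.one_le)
    obtain ⟨N, hN⟩ := exists_prod_near (q := 1 - 1 / p) (by linarith)
      (by linarith [one_div_pos.2 hp0]) ht.1 ht.2
    have hthree (x y : ZMod p) : ∃ z, z ≠ x ∧ z ≠ y := by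
      have hlt : ({x, y} : Finset (ZMod p)).card < (Finset.univ : Finset (ZMod p)).card := by
        rw [card_univ, hcard]
        exact card_le_two.trans_lt (by omega)
      obtain ⟨z, -, hz⟩ := Finset.exists_mem_notMem_of_card_lt_card hlt
      exact ⟨z, by simpa using hz⟩
    have hprim : IsPrimitiveOn (powerGroup (Fin N) (affineGroup (ZMod p))) :=
      isPrimitiveOn_powerGroup affineGroup_transitive affineGroup_stabilizer hthree
    let e := Finite.equivFin (Fin N → ZMod p)
    refine ⟨_, ⟨_, _, Nat.card_pos, (hprim.map_permCongr e).isPrimitiveSubgroup, rfl⟩, ?_⟩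
    rw [fixingProp_map_permCongr, fixingProp_powerGroup, hq, Nat.card_fin, dist_comm,
      Real.dist_eq]
    refine hN.trans_lt ?_
    have hkp : (k : ℝ) < p := by exact_mod_cast (by omega : k < p)
    rw [sub_sub_cancel]
    exact (one_div_lt hε hp0).1 (hk.trans hkp)
  have := closure_minimal hIoc isClosed_closure
  rw [closure_Ioc zero_ne_one] at this
  exact this ht

theorem deltaP_mem_Icc {m n : ℕ} (A : Subgroup (Perm (Fin m))) (B : Subgroup (Perm (Fin n)))
    (k : ℕ) : deltaP A B k ∈ Set.Icc (0 : ℝ) 1 := by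
  refine ⟨by unfold deltaP propFixVia; positivity, div_le_one_of_le₀ ?_ (by positivity)⟩
  exact_mod_cast Set.ncard_le_ncard (Set.sep_subset _ _) (Set.toFinite _)

/-- **Theorem (density for power-action wreath products, varying primitive `A`).**
For fixed `B ≤ S_n`, the set `{δ(A ≀_P B) : A ≤ S_m primitive, m ∈ ℕ}`
is dense in `[0, 1]`. -/
theorem dense_delta_power_wreath_primitive_A (n : ℕ) (hn : 1 ≤ n)
    (B : Subgroup (Equiv.Perm (Fin n))) :
    {x : ℝ | ∃ (m : ℕ) (A : Subgroup (Equiv.Perm (Fin m))),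
        1 ≤ m ∧ IsPrimitiveSubgroup A ∧ x = deltaP A B 0} ⊆ Set.Icc (0 : ℝ) 1 ∧
    Set.Icc (0 : ℝ) 1 ⊆
      closure {x : ℝ | ∃ (m : ℕ) (A : Subgroup (Equiv.Perm (Fin m))),
        1 ≤ m ∧ IsPrimitiveSubgroup A ∧ x = deltaP A B 0} := by
  refine ⟨?_, fun t ht => ?_⟩
  · rintro _ ⟨m, A, -, -, rfl⟩
    exact deltaP_mem_Icc A B 0
  obtain ⟨F, hF, h0, h1, hδ⟩ := exists_continuous_deltaP_zero_eq hn B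
  obtain ⟨x, hx, rfl⟩ := intermediate_value_Icc' zero_le_one hF.continuousOn
    (by rwa [h0, h1] : t ∈ Set.Icc (F 1) (F 0))
  refine map_mem_closure hF (mem_closure_fixingProp hx) ?_
  rintro _ ⟨m, A, hm, hA, rfl⟩
  exact ⟨m, A, hm, hA, (hδ m A).symm⟩
end
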